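/- arXiv:2111.02192 — 3 statements merged into one kernel-verified Lean document; each statement's English description precedes it below -/
import Mathlib

section
/- Let r ≥ 1 and let S ⊆ ℤ^r be a finite set whose difference set L_S spans ℝ^r (equivalently, the convex hull of S has dimension r). Assume that for every hyperplane H generated by L_S, the image φ_H(S) has at least r+1 elements. Let I₀ ∈ ℤ^r \ S and set S' = S ∪ {I₀}. Then for every hyperplane H' generated by L_{S'}, the image φ_{H'}(S') has at least r+1 elements. -/
open scoped BigOperators

noncomputable section

/-- The embedding of `ℤ^r` into `ℝ^r`. -/
def toR {r : ℕ} (x : Fin r → ℤ) : Fin r → ℝ := fun i => (x i : ℝ)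

/-- The difference set `L_S = {x - y : x, y ∈ S} ⊆ ℝ^r` of a finite set `S ⊆ ℤ^r`. -/
def LS {r : ℕ} (S : Finset (Fin r → ℤ)) : Set (Fin r → ℝ) :=
  {d | ∃ x ∈ S, ∃ y ∈ S, d = toR x - toR y}

/-- `H` is a hyperplane generated by `L_S`: an `(r-1)`-dimensional linear subspace of `ℝ^r`
spanned by a subset of `L_S`. -/
def IsGenHyperplane {r : ℕ} (S : Finset (Fin r → ℤ)) (H : Submodule ℝ (Fin r → ℝ)) : Prop :=
  Module.finrank ℝ H = r - 1 ∧ ∃ T : Set (Fin r → ℝ), T ⊆ LS S ∧ H = Submodule.span ℝ T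

/-- The number `|φ_H(S)|` of distinct images of the points of `S` under the quotient map
`φ_H : ℝ^r → ℝ^r / H`. -/
def quotImgCard {r : ℕ} (S : Finset (Fin r → ℤ)) (H : Submodule ℝ (Fin r → ℝ)) : ℕ :=
  ((fun x => H.mkQ (toR x)) '' (S : Set (Fin r → ℤ))).ncard

/-- If `X` spans `V` and `Y ⊆ X` does not, then some subset of `X` spans a hyperplane of `V`
containing `Y`. -/
theorem exists_subset_span_hyperplane_of_span_ne_top {K V : Type*} [DivisionRing K]
    [AddCommGroup V] [Module K V] [FiniteDimensional K V] {X Y : Set V} (hYX : Y ⊆ X)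
    (hX : Submodule.span K X = ⊤) (hY : Submodule.span K Y ≠ ⊤) :
    ∃ T ⊆ X, Submodule.span K Y ≤ Submodule.span K T ∧
      Module.finrank K (Submodule.span K T) = Module.finrank K V - 1 := by
  obtain ⟨b, hbY, -, hYb, hb⟩ :=
    exists_linearIndepOn_extension (linearIndepOn_empty K (id : V → V)) (Set.empty_subset Y)
  obtain ⟨c, hcX, hbc, hXc, hc⟩ := exists_linearIndepOn_extension hb (hbY.trans hYX)
  simp only [Set.image_id] at hYb hXc
  have hctop : Submodule.span K c = ⊤ := by
    rw [eq_top_iff, ← hX]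
    exact Submodule.span_le.2 hXc
  obtain ⟨x, hxc, hxb⟩ : ∃ x ∈ c, x ∉ b := by
    by_contra! h
    have hcb : Submodule.span K c ≤ Submodule.span K Y :=
      Submodule.span_mono fun y hy => hbY (h y hy)
    exact hY (eq_top_iff.2 (hctop ▸ hcb))
  have hcfin : c.Finite := LinearIndependent.setFinite hc
  have hrank : ∀ s ⊆ c, Module.finrank K (Submodule.span K s) = s.ncard := fun s hs => by
    have : Fintype s := (hcfin.subset hs).fintype
    rw [finrank_span_set_eq_card (hc.mono hs), Set.ncard_eq_toFinset_card']
  refine ⟨c \ {x}, Set.sdiff_subset.trans hcX, ?_, ?_⟩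
  · refine (Submodule.span_le.2 hYb).trans (Submodule.span_mono fun y hy => ⟨hbc hy, ?_⟩)
    rintro rfl
    exact hxb hy
  · rw [hrank _ Set.sdiff_subset, Set.ncard_sdiff_singleton_of_mem hxc, ← hrank c subset_rfl, hctop,
      finrank_top]

/-- If all differences of points of `S` lying in `H'` lie in `H`, then `φ_H(S)` has at most as many
elements as `φ_{H'}(S')` for every `S' ⊇ S`. -/
theorem quotImgCard_le_of_inter_subset {r : ℕ} {S S' : Finset (Fin r → ℤ)} (hSS' : S ⊆ S')
    {H H' : Submodule ℝ (Fin r → ℝ)} (h : LS S ∩ H' ⊆ H) :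
    quotImgCard S H ≤ quotImgCard S' H' := by
  classical
  unfold quotImgCard
  refine le_trans ?_ (Set.ncard_le_ncard (Set.image_mono (Finset.coe_subset.2 hSS'))
    (S'.finite_toSet.image _))
  simp only [← Finset.coe_image, Set.ncard_coe_finset]
  have hfactor : ∀ x ∈ S, ∀ y ∈ S, H'.mkQ (toR x) = H'.mkQ (toR y) →
      H.mkQ (toR x) = H.mkQ (toR y) := fun x hx y hy hxy =>
    (Submodule.Quotient.eq H).2 (h ⟨⟨x, hx, y, hy, rfl⟩, (Submodule.Quotient.eq H').1 hxy⟩)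
  refine Finset.card_le_card_of_forall_subsingleton
    (fun a b => ∃ x ∈ S, H.mkQ (toR x) = a ∧ H'.mkQ (toR x) = b) ?_ ?_
  · intro a ha
    obtain ⟨x, hx, rfl⟩ := Finset.mem_image.1 ha
    exact ⟨_, Finset.mem_image_of_mem _ hx, x, hx, rfl, rfl⟩
  · rintro b - a ⟨-, x, hx, rfl, hxb⟩ a' ⟨-, y, hy, rfl, hyb⟩
    exact hfactor x hx y hy (hxb.trans hyb.symm)

/-- If `L_S` spans `ℝ^r` and `|φ_H(S)| ≥ r + 1` for every hyperplane `H` generated by `L_S`,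
then the same lower bound holds for every hyperplane generated by `L_{S ∪ {I₀}}`. -/
theorem adjoin_point_preserves_quotient_card_bound {r : ℕ} (hr : 1 ≤ r)
    (S : Finset (Fin r → ℤ))
    (hspan : Submodule.span ℝ (LS S) = ⊤)
    (hS : ∀ H : Submodule ℝ (Fin r → ℝ), IsGenHyperplane S H → r + 1 ≤ quotImgCard S H)
    (I₀ : Fin r → ℤ) (hI₀ : I₀ ∉ S) :
    ∀ H' : Submodule ℝ (Fin r → ℝ), IsGenHyperplane (insert I₀ S) H' →
      r + 1 ≤ quotImgCard (insert I₀ S) H' := by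
  rintro H' ⟨hH', -⟩
  have hle : Submodule.span ℝ (LS S ∩ H') ≤ H' := Submodule.span_le.2 Set.inter_subset_right
  have hne : Submodule.span ℝ (LS S ∩ H') ≠ ⊤ := by
    intro htop
    rw [htop, top_le_iff] at hle
    rw [hle, finrank_top, Module.finrank_fin_fun] at hH'
    omega
  obtain ⟨T, hT, hWT, hrank⟩ :=
    exists_subset_span_hyperplane_of_span_ne_top Set.inter_subset_left hspan hne
  rw [Module.finrank_fin_fun] at hrank
  exact (hS _ ⟨hrank, T, hT, rfl⟩).trans
    (quotImgCard_le_of_inter_subset (Finset.subset_insert I₀ S) (Submodule.span_le.1 hWT))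
end
end

section
/- Let r ≥ 1, let S ⊆ ℤ^r be finite and let a : S → ℂ. Then Z(p_a) or its complement (ℂ*)^r \ Z(p_a) contains a coset of a one-dimensional subtorus if and only if there exist c ∈ (ℂ*)^r and a nonzero v ∈ ℤ^r such that at most one integer d satisfies Q_{a,v,d}(c) ≠ 0. -/
open scoped BigOperators

noncomputable section

/-- The Laurent monomial `z^I = ∏ i, z i ^ (I i)` with integer exponents. -/
def lmon {r : ℕ} (z : Fin r → ℂ) (I : Fin r → ℤ) : ℂ :=
  ∏ i, z i ^ (I i)

/-- The Laurent polynomial `p_a(z) = Σ_{I ∈ S} a(I) z^I`. -/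
def pa {r : ℕ} (S : Finset (Fin r → ℤ)) (a : (Fin r → ℤ) → ℂ) (z : Fin r → ℂ) : ℂ :=
  ∑ I ∈ S, a I * lmon z I

/-- The algebraic torus `(ℂ*)^r`, as a subset of `ℂ^r`. -/
def torus (r : ℕ) : Set (Fin r → ℂ) := {z | ∀ i, z i ≠ 0}

/-- The zero set `Z(p_a) = {z ∈ (ℂ*)^r : p_a(z) = 0}`. -/
def Zset {r : ℕ} (S : Finset (Fin r → ℤ)) (a : (Fin r → ℤ) → ℂ) : Set (Fin r → ℂ) :=
  {z | (∀ i, z i ≠ 0) ∧ pa S a z = 0}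

/-- The coset `C(c,v) = {(c_1 t^{v_1}, …, c_r t^{v_r}) : t ∈ ℂ*}` of a
one-dimensional subtorus (for `c ∈ (ℂ*)^r` and `v ∈ ℤ^r` nonzero). -/
def coset {r : ℕ} (c : Fin r → ℂ) (v : Fin r → ℤ) : Set (Fin r → ℂ) :=
  {z | ∃ t : ℂ, t ≠ 0 ∧ z = fun i => c i * t ^ (v i)}

/-- The grouped coefficient `Q_{a,v,d}(c) = Σ_{I ∈ S, ⟨I,v⟩ = d} a(I) c^I`. -/
def Qc {r : ℕ} (S : Finset (Fin r → ℤ)) (a : (Fin r → ℤ) → ℂ) (v : Fin r → ℤ)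
    (d : ℤ) (c : Fin r → ℂ) : ℂ :=
  ∑ I ∈ S.filter (fun I => (∑ i, I i * v i) = d), a I * lmon c I

open Polynomial in
/-- A Laurent polynomial in one variable with at least two nonzero coefficients takes both
zero and nonzero values on `ℂ*`. -/
theorem exists_zero_and_exists_ne_zero_of_two_coeff_ne_zero (D : Finset ℤ) (q : ℤ → ℂ)
    {d e : ℤ} (hd : d ∈ D) (he : e ∈ D) (hqd : q d ≠ 0) (hqe : q e ≠ 0) (hde : d ≠ e) :
    (∃ t : ℂ, t ≠ 0 ∧ ∑ k ∈ D, q k * t ^ k = 0) ∧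
      ∃ t : ℂ, t ≠ 0 ∧ ∑ k ∈ D, q k * t ^ k ≠ 0 := by
  set E := D.filter (fun k => q k ≠ 0) with hE
  have hdE : d ∈ E := by simp [hE, hd, hqd]
  have heE : e ∈ E := by simp [hE, he, hqe]
  have hne : E.Nonempty := ⟨d, hdE⟩
  set m := E.min' hne with hm
  have hmE : m ∈ E := E.min'_mem hne
  have hle : ∀ k ∈ E, m ≤ k := fun k hk => E.min'_le k hk
  set P : ℂ[X] := ∑ k ∈ E, C (q k) * X ^ (k - m).toNat with hP
  have hcoeff : ∀ k ∈ E, P.coeff (k - m).toNat = q k := by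
    intro k hk
    simp only [hP, finsetSum_coeff, coeff_C_mul, coeff_X_pow]
    rw [Finset.sum_eq_single k]
    · simp
    · intro j hj hjk
      have h1 := hle j hj
      have h2 := hle k hk
      rw [if_neg (by omega), mul_zero]
    · exact fun h => absurd hk h
  have heval : ∀ t : ℂ, t ≠ 0 → ∑ k ∈ D, q k * t ^ k = t ^ m * P.eval t := by
    intro t ht
    have hDE : ∑ k ∈ E, q k * t ^ k = ∑ k ∈ D, q k * t ^ k :=
      Finset.sum_filter_of_ne fun k _ h => left_ne_zero_of_mul h
    rw [← hDE, hP, eval_finsetSum, Finset.mul_sum]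
    refine Finset.sum_congr rfl fun k hk => ?_
    have hk' : ((k - m).toNat : ℤ) = k - m := Int.toNat_of_nonneg (sub_nonneg.2 (hle k hk))
    have hpow : t ^ k = t ^ m * t ^ (k - m).toNat := by
      rw [← zpow_natCast, hk', ← zpow_add₀ ht]
      congr 1
      ring
    simp only [eval_mul, eval_C, eval_pow, eval_X, hpow]
    ring
  have hP0 : P.coeff 0 ≠ 0 := by
    have h := hcoeff m hmE
    rw [sub_self, Int.toNat_zero] at h
    rw [h]
    exact (Finset.mem_filter.1 hmE).2
  have hPne : P ≠ 0 := fun h => hP0 (by rw [h, coeff_zero])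
  obtain ⟨n, hnE, hnm⟩ : ∃ n ∈ E, n ≠ m := by
    by_cases h : d = m
    · exact ⟨e, heE, fun h' => hde (h.trans h'.symm)⟩
    · exact ⟨d, hdE, h⟩
  have hdeg : P.degree ≠ 0 := by
    intro h
    have hlt : P.degree < ((n - m).toNat : ℕ) := by
      have := hle n hnE
      rw [h]
      exact_mod_cast (by omega : 0 < (n - m).toNat)
    have h0 := coeff_eq_zero_of_degree_lt hlt
    rw [hcoeff n hnE] at h0
    exact (Finset.mem_filter.1 hnE).2 h0
  constructor
  · obtain ⟨t, ht⟩ := IsAlgClosed.exists_root P hdeg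
    have ht0 : t ≠ 0 := by
      rintro rfl
      exact hP0 (by rw [coeff_zero_eq_eval_zero]; exact ht)
    exact ⟨t, ht0, by rw [heval t ht0, ht.eq_zero, mul_zero]⟩
  · obtain ⟨t, ht⟩ : ∃ t, (X * P).eval t ≠ 0 := by
      by_contra! h
      exact mul_ne_zero X_ne_zero hPne (Polynomial.funext fun t => by simpa using h t)
    rw [eval_mul, eval_X] at ht
    have ht0 := left_ne_zero_of_mul ht
    refine ⟨t, ht0, ?_⟩
    rw [heval t ht0]
    exact mul_ne_zero (zpow_ne_zero _ ht0) (right_ne_zero_of_mul ht)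

theorem lmon_mul_zpow {r : ℕ} (c : Fin r → ℂ) (v I : Fin r → ℤ) {t : ℂ} (ht : t ≠ 0) :
    lmon (fun i => c i * t ^ v i) I = lmon c I * t ^ (∑ i, I i * v i) := by
  have hsum : t ^ (∑ i, I i * v i) = ∏ i, t ^ (I i * v i) := by
    induction (Finset.univ : Finset (Fin r)) using Finset.induction_on with
    | empty => simp
    | insert i s hi ih => rw [Finset.sum_insert hi, Finset.prod_insert hi, zpow_add₀ ht, ih]
  rw [lmon, lmon, hsum, ← Finset.prod_mul_distrib]
  refine Finset.prod_congr rfl fun i _ => ?_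
  rw [mul_zpow, ← zpow_mul, mul_comm (v i)]

/-- On the coset `C(c,v)` the polynomial `p_a` is the one-variable Laurent polynomial whose
coefficients are the grouped coefficients. -/
theorem pa_mul_zpow {r : ℕ} (S : Finset (Fin r → ℤ)) (a : (Fin r → ℤ) → ℂ)
    (c : Fin r → ℂ) (v : Fin r → ℤ) {t : ℂ} (ht : t ≠ 0) :
    pa S a (fun i => c i * t ^ v i) =
      ∑ d ∈ S.image (fun I => ∑ i, I i * v i), Qc S a v d c * t ^ d := by
  rw [pa, ← Finset.sum_fiberwise_of_maps_to
    (fun I hI => Finset.mem_image_of_mem (fun I : Fin r → ℤ => ∑ i, I i * v i) hI)]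
  refine Finset.sum_congr rfl fun d _ => ?_
  rw [Qc, Finset.sum_mul]
  refine Finset.sum_congr rfl fun I hI => ?_
  rw [lmon_mul_zpow c v I ht, (Finset.mem_filter.1 hI).2, mul_assoc]

theorem mem_image_of_Qc_ne_zero {r : ℕ} {S : Finset (Fin r → ℤ)} {a : (Fin r → ℤ) → ℂ}
    {c : Fin r → ℂ} {v : Fin r → ℤ} {d : ℤ} (h : Qc S a v d c ≠ 0) :
    d ∈ S.image (fun I => ∑ i, I i * v i) := by
  obtain ⟨I, hI, -⟩ := Finset.exists_ne_zero_of_sum_ne_zero h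
  exact Finset.mem_image.2 ⟨I, Finset.mem_filter.1 hI⟩

/-- `Z(p_a)` or its complement in `(ℂ*)^r` contains a coset of a one-dimensional
subtorus if and only if there exist `c ∈ (ℂ*)^r` and `v ∈ ℤ^r` nonzero such that
at most one integer `d` satisfies `Q_{a,v,d}(c) ≠ 0`. -/
theorem zero_set_or_complement_contains_coset_iff {r : ℕ} (hr : 1 ≤ r)
    (S : Finset (Fin r → ℤ)) (a : (Fin r → ℤ) → ℂ) :
    ((∃ c : Fin r → ℂ, ∃ v : Fin r → ℤ, (∀ i, c i ≠ 0) ∧ v ≠ 0 ∧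
        coset c v ⊆ Zset S a) ∨
     (∃ c : Fin r → ℂ, ∃ v : Fin r → ℤ, (∀ i, c i ≠ 0) ∧ v ≠ 0 ∧
        coset c v ⊆ torus r \ Zset S a))
    ↔
    (∃ c : Fin r → ℂ, ∃ v : Fin r → ℤ, (∀ i, c i ≠ 0) ∧ v ≠ 0 ∧
        {d : ℤ | Qc S a v d c ≠ 0}.Subsingleton) := by
  have hcoset : ∀ {c : Fin r → ℂ} {v : Fin r → ℤ} {t : ℂ}, (∀ i, c i ≠ 0) → t ≠ 0 →
      ∀ i, c i * t ^ v i ≠ 0 := fun hc ht i => mul_ne_zero (hc i) (zpow_ne_zero _ ht)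
  constructor
  · rintro (⟨c, v, hc, hv, h⟩ | ⟨c, v, hc, hv, h⟩) <;>
      refine ⟨c, v, hc, hv, fun d hd e he => by_contra fun hde => ?_⟩ <;>
      obtain ⟨⟨t, ht, hzero⟩, s, hs, hnonzero⟩ :=
        exists_zero_and_exists_ne_zero_of_two_coeff_ne_zero _ (fun k => Qc S a v k c)
          (mem_image_of_Qc_ne_zero hd) (mem_image_of_Qc_ne_zero he) hd he hde
    · exact hnonzero ((pa_mul_zpow S a c v hs).symm.trans (h ⟨s, hs, rfl⟩).2)
    · exact (h ⟨t, ht, rfl⟩).2 ⟨hcoset hc ht, (pa_mul_zpow S a c v ht).trans hzero⟩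
  · rintro ⟨c, v, hc, hv, h⟩
    by_cases hQ : ∃ d, Qc S a v d c ≠ 0
    · obtain ⟨d, hd⟩ := hQ
      refine Or.inr ⟨c, v, hc, hv, ?_⟩
      rintro _ ⟨t, ht, rfl⟩
      refine ⟨hcoset hc ht, fun hz => ?_⟩
      have hsum := hz.2
      rw [pa_mul_zpow S a c v ht, Finset.sum_eq_single_of_mem d (mem_image_of_Qc_ne_zero hd)
        fun e _ hed => by
          rw [show Qc S a v e c = 0 from by_contra fun he => hed (h he hd), zero_mul]] at hsum
      exact mul_ne_zero hd (zpow_ne_zero _ ht) hsum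
    · push Not at hQ
      refine Or.inl ⟨c, v, hc, hv, ?_⟩
      rintro _ ⟨t, ht, rfl⟩
      exact ⟨hcoset hc ht, by simp [pa_mul_zpow S a c v ht, hQ]⟩
end
end

section
/- Let r ≥ 1 and let S ⊆ ℤ^r be a finite set such that L_S spans ℝ^r and such that for every hyperplane H generated by L_S one has |φ_H(S)| ≥ r+1. Then there exists a nonzero homogeneous polynomial F of positive degree in the variables (X_I)_{I ∈ S} with complex coefficients such that for every a : S → ℂ with F((a(I))_{I∈S}) ≠ 0, neither Z(p_a) nor (ℂ*)^r \ Z(p_a) contains a coset of a one-dimensional subtorus. -/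
open scoped BigOperators

noncomputable section

/-- More polynomials than variables are algebraically dependent. -/
lemma exists_aeval_eq_zero_of_card_lt {K ι κ : Type*} [Field K] [Fintype ι] [Fintype κ]
    (ψ : ι → MvPolynomial κ K) (h : Fintype.card κ < Fintype.card ι) :
    ∃ F : MvPolynomial ι K, F ≠ 0 ∧ MvPolynomial.aeval ψ F = 0 := by
  by_contra! hcon
  have hind : AlgebraicIndependent K ψ := by
    rw [algebraicIndependent_iff]
    intro F hF
    by_contra h0
    exact hcon F h0 hF
  have := hind.lift_cardinalMk_le_trdeg
  rw [MvPolynomial.trdeg_of_isDomain] at this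
  simp only [Cardinal.mk_fintype, Cardinal.lift_natCast, Nat.cast_le] at this
  omega

open MvPolynomial in
/-- Given a partition of `ι` into at least `r + 1` classes with representatives `g`, the
coefficient vectors `a` for which all class sums but the one of `d₀` vanish at a point `c` with
nonzero coordinates and `c i₀ = 1` lie in the zero set of a nonzero polynomial. -/
lemma exists_poly_of_idempotent {ι : Type*} [Fintype ι] [DecidableEq ι] {r : ℕ}
    (e : ι → Fin r → ℕ) (g : ι → ι) (hg : ∀ x, g (g x) = g x)
    (hc : r + 1 ≤ (Finset.univ.image g).card) (d₀ : ι) (i₀ : Fin r) :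
    ∃ F : MvPolynomial ι ℂ, F ≠ 0 ∧ ∀ (a : ι → ℂ) (c : Fin r → ℂ), (∀ i, c i ≠ 0) → c i₀ = 1 →
      (∀ d, d ≠ d₀ → ∑ J with g J = d, a J * ∏ i, c i ^ e J i = 0) → eval a F = 0 := by
  classical
  let R : ι → Prop := fun I => g I = I ∧ I ≠ d₀
  let κ := {I // ¬ R I} ⊕ {i // i ≠ i₀}
  let x : ι → MvPolynomial κ ℂ := fun J => if h : R J then 0 else X (Sum.inl ⟨J, h⟩)
  let y : Fin r → MvPolynomial κ ℂ := fun i => if h : i = i₀ then 1 else X (Sum.inr ⟨i, h⟩)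
  let M : ι → MvPolynomial κ ℂ := fun J => ∏ i, y i ^ e J i
  let ψ : ι → MvPolynomial κ ℂ := fun I =>
    if R I then -∑ J with g J = I, x J * M J else x I * M (g I)
  have hR : r ≤ Fintype.card {I // R I} := by
    have h1 : (Finset.univ.image g).erase d₀ ⊆ Finset.univ.filter R := by
      intro I hI
      simp only [Finset.mem_erase, Finset.mem_image, Finset.mem_univ, true_and] at hI
      obtain ⟨h0, J, rfl⟩ := hI
      simp [R, hg, h0]
    have h2 := Finset.card_le_card h1
    have h3 := Finset.pred_card_le_card_erase (s := Finset.univ.image g) (a := d₀)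
    rw [Fintype.card_of_subtype (Finset.univ.filter R) (by simp)]
    omega
  have hcard : Fintype.card κ < Fintype.card ι := by
    have h1 := Fintype.card_subtype_compl R
    have h2 := Fintype.card_subtype_le R
    have h3 : Fintype.card {i // i ≠ i₀} = r - 1 := by simp
    have h4 : 0 < r := i₀.pos
    rw [Fintype.card_sum]
    omega
  obtain ⟨F, hF0, hF⟩ := exists_aeval_eq_zero_of_card_lt ψ hcard
  refine ⟨F, hF0, fun a c hc0 hc1 hsum => ?_⟩
  let m : ι → ℂ := fun J => ∏ i, c i ^ e J i
  have hm (J) : m J ≠ 0 := Finset.prod_ne_zero_iff.mpr fun i _ => pow_ne_zero _ (hc0 i)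
  let p : κ → ℂ := Sum.elim (fun J => a J / m (g J)) (fun i => c i)
  have hx (J) (h : ¬ R J) : eval p (x J) = a J / m (g J) := by simp [x, h, p]
  have hx0 (J) (h : R J) : eval p (x J) = 0 := by simp [x, h]
  have hy (i) : eval p (y i) = c i := by
    by_cases h : i = i₀
    · subst h; simp [y, hc1]
    · simp [y, h, p]
  have hM (J) : eval p (M J) = m J := by simp [M, m, hy]
  have hψ (I) : eval p (ψ I) = a I := by
    by_cases h : R I
    · have h1 := hsum I h.2
      rw [← Finset.add_sum_erase _ _ (by simp [h.1] : I ∈ Finset.univ.filter (g · = I))] at h1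
      have h2 : eval p (∑ J with g J = I, x J * M J)
          = (∑ J ∈ (Finset.univ.filter (g · = I)).erase I, a J * m J) / m I := by
        rw [← Finset.add_sum_erase _ _ (by simp [h.1] : I ∈ Finset.univ.filter (g · = I))]
        rw [map_add, map_mul, hx0 I h, zero_mul, zero_add, map_sum, Finset.sum_div]
        refine Finset.sum_congr rfl fun J hJ => ?_
        simp only [Finset.mem_erase, Finset.mem_filter, Finset.mem_univ, true_and] at hJ
        have hJR : ¬ R J := fun h' => hJ.1 (h'.1.symm.trans hJ.2)
        rw [map_mul, hx J hJR, hM, hJ.2]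
        ring
      have h3 : ψ I = -∑ J with g J = I, x J * M J := if_pos h
      rw [h3, map_neg, h2, ← neg_div, div_eq_iff (hm I)]
      exact (eq_neg_of_add_eq_zero_left h1).symm
    · have h3 : ψ I = x I * M (g I) := if_neg h
      rw [h3, map_mul, hx I h, hM, div_mul_cancel₀ _ (hm _)]
  have h1 := congrArg (eval p) hF
  rw [map_zero] at h1
  rw [← h1, aeval_def, algebraMap_eq, ← coe_eval₂Hom]
  have : (eval p).comp (eval₂Hom C ψ) = eval a := by
    ext I <;> simp [hψ]
  rw [← this]; rfl

/-- The pairing of an exponent vector with a cocharacter. -/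
def pairing {r : ℕ} (v : Fin r → ℤ) (I : Fin r → ℤ) : ℤ := ∑ i, I i * v i

/-- A translate of a finite set of integer vectors into the nonnegative orthant. -/
lemma exists_shift_nonneg {r : ℕ} (S : Finset (Fin r → ℤ)) :
    ∃ N : ℕ, ∀ I ∈ S, ∀ i, 0 ≤ I i + N := by
  refine ⟨∑ I ∈ S, ∑ i, (I i).natAbs, fun I hI i => ?_⟩
  have h1 : (I i).natAbs ≤ ∑ i, (I i).natAbs :=
    Finset.single_le_sum (f := fun i => (I i).natAbs) (fun _ _ => Nat.zero_le _)
      (Finset.mem_univ i)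
  have h2 : ∑ i, (I i).natAbs ≤ ∑ I ∈ S, ∑ i, (I i).natAbs :=
    Finset.single_le_sum (f := fun I : Fin r → ℤ => ∑ i, (I i).natAbs)
      (fun _ _ => Nat.zero_le _) hI
  omega

lemma lmon_twist {r : ℕ} (c : Fin r → ℂ) (v I : Fin r → ℤ) {t : ℂ} (ht : t ≠ 0) :
    lmon (fun i => c i * t ^ v i) I = t ^ pairing v I * lmon c I := by
  have h (s : Finset (Fin r)) (f : Fin r → ℤ) : t ^ (∑ i ∈ s, f i) = ∏ i ∈ s, t ^ f i := by
    classical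
    induction s using Finset.induction_on with
    | empty => simp
    | insert j s hj ih => rw [Finset.sum_insert hj, Finset.prod_insert hj, zpow_add₀ ht, ih]
  simp only [lmon, pairing, h, mul_zpow, Finset.prod_mul_distrib, ← zpow_mul]
  rw [mul_comm]
  simp only [mul_comm]

lemma Qc_twist {r : ℕ} (S : Finset (Fin r → ℤ)) (a : (Fin r → ℤ) → ℂ) (c : Fin r → ℂ)
    (v : Fin r → ℤ) (d : ℤ) {t : ℂ} (ht : t ≠ 0) :
    Qc S a v d (fun i => c i * t ^ v i) = t ^ d * Qc S a v d c := by
  unfold Qc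
  rw [Finset.mul_sum]
  refine Finset.sum_congr rfl fun I hI => ?_
  have hI : pairing v I = d := (Finset.mem_filter.mp hI).2
  rw [lmon_twist c v I ht, hI]
  ring

lemma exists_zpow_eq {k : ℤ} (hk : k ≠ 0) {x : ℂ} (hx : x ≠ 0) : ∃ t : ℂ, t ≠ 0 ∧ t ^ k = x := by
  obtain ⟨t, ht⟩ := IsAlgClosed.exists_pow_nat_eq x (Int.natAbs_pos.mpr hk)
  have ht0 : t ≠ 0 := by
    rintro rfl
    rw [zero_pow (Int.natAbs_ne_zero.mpr hk)] at ht
    exact hx ht.symm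
  rcases Int.natAbs_eq k with h | h
  · exact ⟨t, ht0, by rw [h, zpow_natCast, ht]⟩
  · exact ⟨t⁻¹, inv_ne_zero ht0, by rw [h, zpow_neg, zpow_natCast, inv_pow, inv_inv, ht]⟩

/-- If every nonzero cocharacter takes at least `r + 1` values on `S`, then the coefficient
vectors having at most one nonzero grouped coefficient for some `(c, v)` lie in a hypersurface. -/
lemma exists_poly_of_Qc {r : ℕ} (S : Finset (Fin r → ℤ)) (hS : S.Nonempty)
    (hv : ∀ v : Fin r → ℤ, v ≠ 0 → r + 1 ≤ (S.image (pairing v)).card) :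
    ∃ F : MvPolynomial S ℂ, F ≠ 0 ∧ ∀ (a : (Fin r → ℤ) → ℂ) (c : Fin r → ℂ) (v : Fin r → ℤ)
      (d₀ : ℤ), (∀ i, c i ≠ 0) → v ≠ 0 → (∀ d, d ≠ d₀ → Qc S a v d c = 0) →
      MvPolynomial.eval (fun I : S => a I) F = 0 := by
  classical
  obtain ⟨N, hN⟩ := exists_shift_nonneg S
  let e : S → Fin r → ℕ := fun I i => ((I : Fin r → ℤ) i + N).toNat
  let T := {g : S → S // (∀ x, g (g x) = g x) ∧ r + 1 ≤ (Finset.univ.image g).card}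
  choose G hG0 hG using fun p : T × S × Fin r =>
    exists_poly_of_idempotent e p.1.1 p.1.2.1 p.1.2.2 p.2.1 p.2.2
  refine ⟨∏ p, G p, Finset.prod_ne_zero_iff.mpr fun p _ => hG0 p, ?_⟩
  intro a c v d₀ hc hv0 hQ
  obtain ⟨i₀, hi₀⟩ := Function.ne_iff.mp hv0
  obtain ⟨t, ht, htc⟩ := exists_zpow_eq hi₀ (inv_ne_zero (hc i₀))
  let c' : Fin r → ℂ := fun i => c i * t ^ v i
  have hc' (i) : c' i ≠ 0 := mul_ne_zero (hc i) (zpow_ne_zero _ ht)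
  have hc'1 : c' i₀ = 1 := by simp [c', htc, hc i₀]
  have hQ' (d) (hd : d ≠ d₀) : Qc S a v d c' = 0 := by
    rw [Qc_twist S a c v d ht, hQ d hd, mul_zero]
  let h : S → ℤ := fun I => pairing v I
  let g : S → S := fun I => Set.rangeSplitting h ⟨h I, Set.mem_range_self I⟩
  have hhg (I) : h (g I) = h I := Set.apply_rangeSplitting h ⟨h I, Set.mem_range_self I⟩
  have hgh {I J} (hIJ : h I = h J) : g I = g J := by simp only [g, hIJ]
  have hgg (I) : g (g I) = g I := hgh (hhg I)
  have hcard : r + 1 ≤ (Finset.univ.image g).card := by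
    refine (hv v hv0).trans ((Finset.card_le_card ?_).trans
      (Finset.card_image_le (s := Finset.univ.image g) (f := h)))
    intro d hd
    obtain ⟨I, hI, rfl⟩ := Finset.mem_image.mp hd
    refine Finset.mem_image.mpr ⟨g ⟨I, hI⟩, by simp, hhg ⟨I, hI⟩⟩
  obtain ⟨J₀, hJ₀⟩ : ∃ J₀ : S, ∀ J, h J = d₀ → g J = J₀ := by
    by_cases hex : ∃ J, h J = d₀
    · obtain ⟨J, hJ⟩ := hex
      exact ⟨g J, fun J' hJ' => hgh (hJ'.trans hJ.symm)⟩
    · push Not at hex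
      exact ⟨⟨_, hS.choose_spec⟩, fun J hJ => absurd hJ (hex J)⟩
  rw [map_prod]
  refine Finset.prod_eq_zero (Finset.mem_univ (⟨⟨g, hgg, hcard⟩, J₀, i₀⟩ : T × S × Fin r)) ?_
  refine hG _ (fun I : S => a I) c' hc' hc'1 fun d hd => ?_
  by_cases hgd : g d = d
  · have h1 := hQ' (h d) fun h' => hd (hgd.symm.trans (hJ₀ d h'))
    have hmon (J : S) : ∏ i, c' i ^ e J i = lmon c' J * ∏ i, c' i ^ N := by
      rw [lmon, ← Finset.prod_mul_distrib]
      refine Finset.prod_congr rfl fun i _ => ?_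
      rw [← zpow_natCast, Int.toNat_of_nonneg (hN J J.2 i), zpow_add₀ (hc' i), zpow_natCast]
    have hiff (J : S) : g J = d ↔ pairing v J = h d :=
      ⟨fun hJ => by rw [← hJ, hhg], fun hJ => by rw [← hgd]; exact hgh hJ⟩
    simp only [hmon, hiff, ← mul_assoc]
    rw [← Finset.sum_mul, Finset.sum_filter,
      Finset.sum_coe_sort S fun J => if pairing v J = h d then a J * lmon c' J else 0,
      ← Finset.sum_filter]
    exact mul_eq_zero_of_left h1 _
  · refine Finset.sum_eq_zero fun J hJ => absurd ?_ hgd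
    rw [← (Finset.mem_filter.mp hJ).2]
    exact hgg J

open MvPolynomial in
/-- If a polynomial vanishes along the line through `a`, so do its homogeneous components. -/
lemma eval_homogeneousComponent_eq_zero {K ι : Type*} [Field K] [Infinite K]
    (F : MvPolynomial ι K) (a : ι → K) (h : ∀ t : K, eval (t • a) F = 0) (n : ℕ) :
    eval a (homogeneousComponent n F) = 0 := by
  have hscale (t : K) (k : ℕ) :
      eval (t • a) (homogeneousComponent k F) = eval a (homogeneousComponent k F) * t ^ k := by
    simp only [eval_eq, Finset.sum_mul]
    refine Finset.sum_congr rfl fun d hd => ?_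
    have hdk : d.degree = k := by
      by_contra hne
      rw [mem_support_iff, coeff_homogeneousComponent, if_neg hne] at hd
      exact hd rfl
    simp only [Pi.smul_apply, smul_eq_mul, mul_pow, Finset.prod_mul_distrib,
      Finset.prod_pow_eq_pow_sum]
    rw [show ∑ i ∈ d.support, d i = k from hdk]
    ring
  let f : Polynomial K := ∑ k ∈ Finset.range (F.totalDegree + 1),
    Polynomial.monomial k (eval a (homogeneousComponent k F))
  have hf : f = 0 := by
    refine Polynomial.funext fun t => ?_
    have h1 := h t
    rw [← sum_homogeneousComponent F, map_sum] at h1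
    simpa [f, Polynomial.eval_finsetSum, ← hscale] using h1
  by_cases hn : n < F.totalDegree + 1
  · have h1 := congrArg (fun q => Polynomial.coeff q n) hf
    simpa [f, Polynomial.finsetSum_coeff, Polynomial.coeff_monomial, hn] using h1
  · rw [homogeneousComponent_eq_zero _ _ (by omega), map_zero]

/-- A complex polynomial without nonzero roots is a monomial. -/
lemma exists_forall_ne_coeff_eq_zero (f : Polynomial ℂ)
    (h : (∀ t, t ≠ 0 → f.eval t = 0) ∨ ∀ t, t ≠ 0 → f.eval t ≠ 0) :
    ∃ m, ∀ k, k ≠ m → f.coeff k = 0 := by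
  rcases h with h | h
  · refine ⟨0, fun k _ => ?_⟩
    have : f = 0 := f.eq_zero_of_infinite_isRoot
      ((Set.finite_singleton (0 : ℂ)).infinite_compl.mono fun t ht => h t ht)
    simp [this]
  · have hr : f.roots = Multiset.replicate f.roots.card 0 := by
      refine Multiset.eq_replicate_card.mpr fun t ht => ?_
      by_contra h0
      exact h t h0 (Polynomial.isRoot_of_mem_roots ht)
    have hf := (IsAlgClosed.splits f).eq_prod_roots
    rw [hr] at hf
    simp only [Multiset.map_replicate, Multiset.prod_replicate, map_zero, sub_zero] at hf
    refine ⟨f.roots.card, fun k hk => ?_⟩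
    rw [hf, Polynomial.coeff_C_mul_X_pow, if_neg hk]

lemma exists_forall_ne_Qc_eq_zero {r : ℕ} (S : Finset (Fin r → ℤ)) (a : (Fin r → ℤ) → ℂ)
    (c : Fin r → ℂ) (v : Fin r → ℤ)
    (h : (∀ t, t ≠ 0 → pa S a (fun i => c i * t ^ v i) = 0) ∨
      ∀ t, t ≠ 0 → pa S a (fun i => c i * t ^ v i) ≠ 0) :
    ∃ d₀, ∀ d, d ≠ d₀ → Qc S a v d c = 0 := by
  obtain ⟨N, hN⟩ : ∃ N : ℕ, ∀ I ∈ S, 0 ≤ pairing v I + N := by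
    refine ⟨∑ I ∈ S, (pairing v I).natAbs, fun I hI => ?_⟩
    have := Finset.single_le_sum (f := fun I => (pairing v I).natAbs)
      (fun _ _ => Nat.zero_le _) hI
    omega
  let f : Polynomial ℂ := ∑ I ∈ S, Polynomial.monomial (pairing v I + N).toNat (a I * lmon c I)
  have hf (t : ℂ) (ht : t ≠ 0) : f.eval t = pa S a (fun i => c i * t ^ v i) * t ^ N := by
    simp only [f, Polynomial.eval_finsetSum, Polynomial.eval_monomial, pa, Finset.sum_mul]
    refine Finset.sum_congr rfl fun I hI => ?_
    rw [lmon_twist c v I ht, ← zpow_natCast, Int.toNat_of_nonneg (hN I hI), zpow_add₀ ht,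
      zpow_natCast]
    ring
  obtain ⟨m, hm⟩ := exists_forall_ne_coeff_eq_zero f <| h.imp
    (fun h t ht => by rw [hf t ht, h t ht, zero_mul])
    (fun h t ht => by rw [hf t ht]; exact mul_ne_zero (h t ht) (pow_ne_zero _ ht))
  refine ⟨m - N, fun d hd => ?_⟩
  by_cases hdN : 0 ≤ d + N
  · rw [← hm (d + N).toNat (by omega)]
    simp only [f, Polynomial.finsetSum_coeff, Polynomial.coeff_monomial, Qc, Finset.sum_filter]
    refine Finset.sum_congr rfl fun I hI => ?_
    have := hN I hI
    refine if_congr ?_ rfl rfl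
    change pairing v I = d ↔ _
    omega
  · refine Finset.sum_eq_zero fun I hI => ?_
    have h1 := hN I (Finset.mem_filter.mp hI).1
    have h2 : pairing v I = d := (Finset.mem_filter.mp hI).2
    omega

/-- A proper subspace contained in the span of `L` and spanned by a subset of `L` extends to a
hyperplane spanned by a subset of `L`. -/
lemma exists_hyperplane_span {V : Type*} [AddCommGroup V] [Module ℝ V] [FiniteDimensional ℝ V]
    {L T₀ : Set V} (hL : Submodule.span ℝ L = ⊤) (hT₀ : T₀ ⊆ L)
    (hne : Submodule.span ℝ T₀ ≠ ⊤) :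
    ∃ T, T₀ ⊆ T ∧ T ⊆ L ∧
      Module.finrank ℝ (Submodule.span ℝ T) = Module.finrank ℝ V - 1 := by
  let P : Set (Submodule ℝ V) := {H | H ≠ ⊤ ∧ ∃ T, T₀ ⊆ T ∧ T ⊆ L ∧ H = Submodule.span ℝ T}
  obtain ⟨H, ⟨hH, T, hT, hTL, rfl⟩, hmax⟩ :=
    (wellFounded_gt (α := Submodule ℝ V)).has_min P ⟨_, hne, T₀, subset_rfl, hT₀, rfl⟩
  refine ⟨T, hT, hTL, ?_⟩
  obtain ⟨x, hxL, hx⟩ : ∃ x ∈ L, x ∉ Submodule.span ℝ T := by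
    by_contra! hcon
    exact hH (top_le_iff.mp (hL ▸ Submodule.span_le.mpr hcon))
  have htop : Submodule.span ℝ T ⊔ Submodule.span ℝ {x} = ⊤ := by
    by_contra hne'
    refine hmax _ ⟨hne', T ∪ {x}, hT.trans Set.subset_union_left,
      Set.union_subset hTL (Set.singleton_subset_iff.mpr hxL), (Submodule.span_union _ _).symm⟩ ?_
    refine lt_of_le_of_ne le_sup_left fun heq => hx ?_
    rw [heq]
    exact Submodule.mem_sup_right (Submodule.mem_span_singleton_self x)
  have h1 := Submodule.finrank_sup_span_singleton (K := ℝ) hx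
  rw [htop, finrank_top] at h1
  omega

/-- Every nonzero cocharacter takes at least `r + 1` values on `S`. -/
lemma le_card_image_pairing {r : ℕ} (S : Finset (Fin r → ℤ))
    (hspan : Submodule.span ℝ (LS S) = ⊤)
    (hcard : ∀ H : Submodule ℝ (Fin r → ℝ), IsGenHyperplane S H → r + 1 ≤ quotImgCard S H)
    (v : Fin r → ℤ) (hv : v ≠ 0) : r + 1 ≤ (S.image (pairing v)).card := by
  classical
  let ℓ : (Fin r → ℝ) →ₗ[ℝ] ℝ := ∑ i, (v i : ℝ) • LinearMap.proj i
  have hℓ (I : Fin r → ℤ) : ℓ (toR I) = pairing v I := by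
    simp [ℓ, toR, pairing, LinearMap.sum_apply, mul_comm]
  have hne : Submodule.span ℝ (LS S ∩ LinearMap.ker ℓ) ≠ ⊤ := by
    intro htop
    have hker : LinearMap.ker ℓ = ⊤ :=
      top_le_iff.mp (htop ▸ Submodule.span_le.mpr Set.inter_subset_right)
    obtain ⟨i, hi⟩ := Function.ne_iff.mp hv
    have : Pi.single i (1 : ℝ) ∈ LinearMap.ker ℓ := hker ▸ Submodule.mem_top
    refine hi ?_
    simpa [ℓ, LinearMap.sum_apply, Pi.single_apply] using this
  obtain ⟨T, hT, hTL, hfin⟩ := exists_hyperplane_span hspan Set.inter_subset_left hne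
  rw [Module.finrank_fin_fun] at hfin
  refine (hcard _ ⟨hfin, T, hTL, rfl⟩).trans ?_
  set H := Submodule.span ℝ T
  have hfac {I J : Fin r → ℤ} (hI : I ∈ S) (hJ : J ∈ S) (h : pairing v I = pairing v J) :
      H.mkQ (toR I) = H.mkQ (toR J) := by
    rw [Submodule.mkQ_apply, Submodule.mkQ_apply, Submodule.Quotient.eq]
    refine Submodule.subset_span (hT ⟨⟨I, hI, J, hJ, rfl⟩, ?_⟩)
    simp [hℓ, h]
  have h1 : quotImgCard S H = (S.image fun I => H.mkQ (toR I)).card := by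
    rw [quotImgCard, ← Finset.coe_image, Set.ncard_coe_finset]
  rw [h1]
  refine Finset.card_le_card_of_surjOn
    (fun d => if h : ∃ I ∈ S, pairing v I = d then H.mkQ (toR h.choose) else 0) ?_
  intro q hq
  obtain ⟨I, hI, rfl⟩ := Finset.mem_image.mp (Finset.mem_coe.mp hq)
  refine ⟨pairing v I, by simpa using ⟨I, hI, rfl⟩, ?_⟩
  have hex : ∃ J ∈ S, pairing v J = pairing v I := ⟨I, hI, rfl⟩
  simp only [dif_pos hex]
  exact hfac hex.choose_spec.1 hI hex.choose_spec.2

/-- If `L_S` spans `ℝ^r` and `|φ_H(S)| ≥ r + 1` for every hyperplane `H` generated by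
`L_S`, then there is a nonzero homogeneous polynomial `F` of positive degree in the
variables `(X_I)_{I ∈ S}` such that whenever `F((a(I))_{I ∈ S}) ≠ 0`, neither `Z(p_a)`
nor its complement in `(ℂ*)^r` contains a coset of a one-dimensional subtorus. -/
theorem exists_homogeneous_poly_detecting_cosets {r : ℕ} (hr : 1 ≤ r)
    (S : Finset (Fin r → ℤ))
    (hspan : Submodule.span ℝ (LS S) = ⊤)
    (hcard : ∀ H : Submodule ℝ (Fin r → ℝ), IsGenHyperplane S H →
      r + 1 ≤ quotImgCard S H) :
    ∃ (n : ℕ) (F : MvPolynomial {I : Fin r → ℤ // I ∈ S} ℂ),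
      0 < n ∧ F ≠ 0 ∧ F.IsHomogeneous n ∧
      ∀ a : (Fin r → ℤ) → ℂ,
        MvPolynomial.eval (fun I : {I : Fin r → ℤ // I ∈ S} => a I.1) F ≠ 0 →
        (¬ ∃ c : Fin r → ℂ, ∃ v : Fin r → ℤ, (∀ i, c i ≠ 0) ∧ v ≠ 0 ∧
            coset c v ⊆ Zset S a) ∧
        (¬ ∃ c : Fin r → ℂ, ∃ v : Fin r → ℤ, (∀ i, c i ≠ 0) ∧ v ≠ 0 ∧
            coset c v ⊆ torus r \ Zset S a) := by
  have hS : S.Nonempty := by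
    rw [Finset.nonempty_iff_ne_empty]
    rintro rfl
    have : LS (∅ : Finset (Fin r → ℤ)) = ∅ := by simp [LS]
    rw [this, Submodule.span_empty] at hspan
    have : Nontrivial (Fin r → ℝ) := by
      have : Nonempty (Fin r) := ⟨⟨0, hr⟩⟩
      infer_instance
    exact bot_ne_top hspan
  obtain ⟨F, hF0, hF⟩ := exists_poly_of_Qc S hS (le_card_image_pairing S hspan hcard)
  obtain ⟨n, hn⟩ : ∃ n, MvPolynomial.homogeneousComponent n F ≠ 0 := by
    by_contra! hcon
    exact hF0 (by rw [← MvPolynomial.sum_homogeneousComponent F]; simp [hcon])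
  obtain ⟨I₀, hI₀⟩ := hS
  refine ⟨n + 1, MvPolynomial.homogeneousComponent n F * MvPolynomial.X ⟨I₀, hI₀⟩, n.succ_pos,
    mul_ne_zero hn (MvPolynomial.X_ne_zero _),
    (MvPolynomial.homogeneousComponent_isHomogeneous n F).mul (MvPolynomial.isHomogeneous_X _ _),
    fun a ha => ?_⟩
  have key (c : Fin r → ℂ) (v : Fin r → ℤ) (hc : ∀ i, c i ≠ 0) (hv : v ≠ 0)
      (h : (∀ t, t ≠ 0 → pa S a (fun i => c i * t ^ v i) = 0) ∨
        ∀ t, t ≠ 0 → pa S a (fun i => c i * t ^ v i) ≠ 0) : False := by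
    obtain ⟨d₀, hd₀⟩ := exists_forall_ne_Qc_eq_zero S a c v h
    refine ha ?_
    rw [map_mul, eval_homogeneousComponent_eq_zero F _ (fun t => ?_) n, zero_mul]
    refine hF (t • a) c v d₀ hc hv fun d hd => ?_
    have h1 : Qc S (t • a) v d c = t * Qc S a v d c := by
      simp [Qc, Finset.mul_sum, mul_assoc]
    rw [h1, hd₀ d hd, mul_zero]
  constructor
  · rintro ⟨c, v, hc, hv, hsub⟩
    exact key c v hc hv (Or.inl fun t ht => (hsub ⟨t, ht, rfl⟩).2)
  · rintro ⟨c, v, hc, hv, hsub⟩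
    refine key c v hc hv (Or.inr fun t ht h0 => ?_)
    have h1 := hsub ⟨t, ht, rfl⟩
    exact h1.2 ⟨h1.1, h0⟩
end
end
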